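/- Let f be an expanding Lorenz map with critical point c admitting a primary n(k)-cycle O = {z_0, …, z_{n-1}} with z_0 < ⋯ < z_{n-k-1} < c < z_{n-k} < ⋯ < z_{n-1}, and assume z_{k-1} ≠ f(0) and z_k ≠ f(1). Put u = f^{n-1}(0) and v = f^{n-1}(1). Then the set of points whose forward orbit never enters (u,v), namely J = {x ∈ [0,1] : there is no m ≥ 0 with f^i(x) ≠ c for 0 ≤ i < m and f^m(x) ∈ (u,v)}, is exactly the cycle: J = O. -/

import Mathlib

open Set Filter Topology Function

/-- `f` is an expanding Lorenz map on `[a,b]` with critical point `c`: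
continuous and strictly increasing on `[a,c)` and `(c,b]`, with
`lim_{x→c⁻} f(x) = b`, `lim_{x→c⁺} f(x) = a`, and differentiable with
derivative uniformly greater than `1` outside a finite set. -/
structure IsExpandingLorenzOn (f : ℝ → ℝ) (c a b : ℝ) : Prop where
  a_lt_c : a < c
  c_lt_b : c < b
  mapsTo : Set.MapsTo f (Set.Icc a b) (Set.Icc a b)
  mono_left : StrictMonoOn f (Set.Ico a c)
  mono_right : StrictMonoOn f (Set.Ioc c b)
  cont_left : ContinuousOn f (Set.Ico a c)
  cont_right : ContinuousOn f (Set.Ioc c b)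
  lim_left : Filter.Tendsto f (nhdsWithin c (Set.Iio c)) (nhds b)
  lim_right : Filter.Tendsto f (nhdsWithin c (Set.Ioi c)) (nhds a)
  expanding : ∃ F : Set ℝ, F.Finite ∧ ∃ lam : ℝ, 1 < lam ∧
    ∀ x ∈ Set.Icc a b \ F, ∃ d : ℝ, HasDerivWithinAt f d (Set.Icc a b) x ∧ lam ≤ d

/-- An expanding Lorenz map on `[0,1]` with critical point `c`. -/
def IsExpandingLorenz (f : ℝ → ℝ) (c : ℝ) : Prop := IsExpandingLorenzOn f c 0 1

/-- A primary `n(k)`-cycle `z 0 < z 1 < ⋯ < z (n-k-1) < c < z (n-k) < ⋯ < z (n-1)`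
for a Lorenz map `f` with critical point `c`. -/
structure IsPrimaryCycle (f : ℝ → ℝ) (c : ℝ) (n k : ℕ) (z : ℕ → ℝ) : Prop where
  k_pos : 0 < k
  k_lt_n : k < n
  coprime : Nat.Coprime n k
  mem : ∀ i < n, z i ∈ Set.Icc (0:ℝ) 1
  mono : ∀ i j : ℕ, i < j → j < n → z i < z j
  left_of_c : ∀ i < n - k, z i < c
  right_of_c : ∀ i : ℕ, n - k ≤ i → i < n → c < z i
  step : ∀ i < n, f (z i) = z ((i + k) % n)
  le_f0 : z (k - 1) ≤ f 0
  f1_le : f 1 ≤ z k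

/-- `g` is a renormalization `(f^l, f^r)` of the Lorenz map `f` on the
renormalization interval `[u,v]`: on `[u,c)` (resp. `(c,v]`) the map `g`
is given by `f^[l]` (resp. `f^[r]`), with values given by one-sided limits
at points where some earlier iterate hits `c`, and `g` is itself an
expanding Lorenz map on `[u,v]` with critical point `c`. -/
structure IsRenormalization (f : ℝ → ℝ) (c : ℝ) (l r : ℕ) (u v : ℝ) (g : ℝ → ℝ) : Prop where
  one_lt_l : 1 < l
  one_lt_r : 1 < r
  u_nonneg : 0 ≤ u
  u_lt_c : u < c
  c_lt_v : c < v
  v_le_one : v ≤ 1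
  proper : 0 < u ∨ v < 1
  eq_left : ∀ x ∈ Set.Ico u c, (∀ i < l, f^[i] x ≠ c) → g x = f^[l] x
  eq_right : ∀ x ∈ Set.Ioc c v, (∀ i < r, f^[i] x ≠ c) → g x = f^[r] x
  lim_left_pt : ∀ x ∈ Set.Ico u c,
    Filter.Tendsto (f^[l]) (nhdsWithin x (Set.Ioi x)) (nhds (g x))
  lim_right_pt : ∀ x ∈ Set.Ioc c v,
    Filter.Tendsto (f^[r]) (nhdsWithin x (Set.Iio x)) (nhds (g x))
  lim_c_left : Filter.Tendsto (f^[l]) (nhdsWithin c (Set.Iio c)) (nhds v)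
  lim_c_right : Filter.Tendsto (f^[r]) (nhdsWithin c (Set.Ioi c)) (nhds u)
  lorenz : IsExpandingLorenzOn g c u v

/-- The forward orbit of `x` enters the set `S` with a `c`-free prefix:
there is `n ≥ 0` with `f^[i] x ≠ c` for `0 ≤ i < n` and `f^[n] x ∈ S`. -/
def CFreeEnters (f : ℝ → ℝ) (c : ℝ) (S : Set ℝ) (x : ℝ) : Prop :=
  ∃ n : ℕ, (∀ i < n, f^[i] x ≠ c) ∧ f^[n] x ∈ S

/-- `N(U) = min {n ≥ 0 : f^[n] z = c for some z ∈ U}`. -/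
noncomputable def hitTime (f : ℝ → ℝ) (c : ℝ) (U : Set ℝ) : ℕ :=
  sInf {n : ℕ | ∃ z ∈ U, f^[n] z = c}

/-- `x ∈ [0,1]` is a `c`-free periodic point of `f` of (exact) period `p`. -/
def IsCFreePeriodic (f : ℝ → ℝ) (c x : ℝ) (p : ℕ) : Prop :=
  x ∈ Set.Icc (0:ℝ) 1 ∧ f^[p] x = x ∧ (∀ i : ℕ, 0 < i → i < p → f^[i] x ≠ x) ∧
    ∀ i < p, f^[i] x ≠ c

/-- Topological transitivity of `f` as a map of `[0,1]`. -/
def LorenzTransitive (f : ℝ → ℝ) : Prop :=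
  ∀ U V : Set ℝ, IsOpen U → IsOpen V →
    (U ∩ Set.Icc 0 1).Nonempty → (V ∩ Set.Icc 0 1).Nonempty →
    ∃ n : ℕ, (f^[n] '' (U ∩ Set.Icc 0 1) ∩ (V ∩ Set.Icc 0 1)).Nonempty

/-- `f` is locally eventually onto: every nonempty (relatively) open subset of `[0,1]`
contains open intervals mapped homeomorphically onto `(0,c)` and onto `(c,1)`
by suitable iterates of `f`. -/
def LocallyEventuallyOnto (f : ℝ → ℝ) (c : ℝ) : Prop :=
  ∀ U : Set ℝ, IsOpen U → (U ∩ Set.Icc 0 1).Nonempty →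
    (∃ a b : ℝ, a < b ∧ Set.Ioo a b ⊆ U ∩ Set.Icc 0 1 ∧ ∃ n : ℕ,
      ContinuousOn (f^[n]) (Set.Ioo a b) ∧ Set.InjOn (f^[n]) (Set.Ioo a b) ∧
        f^[n] '' Set.Ioo a b = Set.Ioo 0 c) ∧
    (∃ a b : ℝ, a < b ∧ Set.Ioo a b ⊆ U ∩ Set.Icc 0 1 ∧ ∃ n : ℕ,
      ContinuousOn (f^[n]) (Set.Ioo a b) ∧ Set.InjOn (f^[n]) (Set.Ioo a b) ∧
        f^[n] '' Set.Ioo a b = Set.Ioo c 1)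

/-- The generalized backward orbit of `x`: points joined to `x` by a chain
following `f`, where at the critical point `c` the chain may continue with
either `0` or `1`. -/
def GenBackwardOrbit (f : ℝ → ℝ) (c x : ℝ) : Set ℝ :=
  {y | y ∈ Set.Icc (0:ℝ) 1 ∧ ∃ (k : ℕ) (w : ℕ → ℝ), w 0 = y ∧ w k = x ∧
    ∀ i < k, (w i ≠ c → w (i + 1) = f (w i)) ∧ (w i = c → w (i + 1) = 0 ∨ w (i + 1) = 1)}

theorem le_of_hasDerivAt_nonneg_off_finset {h : ℝ → ℝ} (F : Finset ℝ) :
    ∀ p q : ℝ, p ≤ q → ContinuousOn h (Icc p q) →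
      (∀ x ∈ Ioo p q, x ∉ F → ∃ d : ℝ, HasDerivAt h d x ∧ 0 ≤ d) → h p ≤ h q := by
  induction F using Finset.induction_on with
  | empty =>
    intro p q hpq hc hd
    have hmono : MonotoneOn h (Icc p q) := by
      refine monotoneOn_of_deriv_nonneg (convex_Icc p q) hc ?_ ?_
      · intro x hx
        rw [interior_Icc] at hx
        obtain ⟨d, h_d, -⟩ := hd x hx (by simp)
        exact h_d.differentiableAt.differentiableWithinAt
      · intro x hx
        rw [interior_Icc] at hx
        obtain ⟨d, h_d, h_nonneg⟩ := hd x hx (by simp)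
        rwa [h_d.deriv]
    exact hmono (left_mem_Icc.2 hpq) (right_mem_Icc.2 hpq) hpq
  | insert a F _ ih =>
    intro p q hpq hc hd
    by_cases ha : a ∈ Ioo p q
    · have h₁ : h p ≤ h a := ih p a ha.1.le (hc.mono (Icc_subset_Icc le_rfl ha.2.le)) fun x hx hxF =>
        hd x ⟨hx.1, hx.2.trans ha.2⟩ (by simp [hx.2.ne, hxF])
      have h₂ : h a ≤ h q := ih a q ha.2.le (hc.mono (Icc_subset_Icc ha.1.le le_rfl)) fun x hx hxF =>
        hd x ⟨ha.1.trans hx.1, hx.2⟩ (by simp [hx.1.ne', hxF])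
      exact h₁.trans h₂
    · refine ih p q hpq hc fun x hx hxF => hd x hx ?_
      have hxa : x ≠ a := by rintro rfl; exact ha hx
      simp [hxa, hxF]

/-- An expanding Lorenz map on `[0,1]` stretches distances on each branch by a uniform factor,
also when one endpoint is the critical point with the value given by the one-sided limit. -/
theorem IsExpandingLorenz.exists_stretch {f : ℝ → ℝ} {c : ℝ} (hf : IsExpandingLorenz f c) :
    ∃ lam : ℝ, 1 < lam ∧
      (∀ p q, 0 ≤ p → p ≤ q → q < c → lam * (q - p) ≤ f q - f p) ∧
      (∀ p q, c < p → p ≤ q → q ≤ 1 → lam * (q - p) ≤ f q - f p) ∧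
      (∀ p, 0 ≤ p → p < c → lam * (c - p) ≤ 1 - f p) ∧
      (∀ q, c < q → q ≤ 1 → lam * (q - c) ≤ f q) := by
  obtain ⟨F, hF, lam, hlam, hd⟩ := hf.expanding
  have hc0 : 0 < c := hf.a_lt_c
  have hc1 : c < 1 := hf.c_lt_b
  have key : ∀ p q, 0 ≤ p → p ≤ q → q ≤ 1 → ContinuousOn f (Icc p q) →
      lam * (q - p) ≤ f q - f p := by
    intro p q hp hpq hq hcont
    have := le_of_hasDerivAt_nonneg_off_finset (h := fun x => f x - lam * x) hF.toFinset p q hpq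
      (by fun_prop) (by
        intro x hx hxF
        have hx0 : 0 < x := hp.trans_lt hx.1
        have hx1 : x < 1 := hx.2.trans_le hq
        obtain ⟨d, h_d, h_le⟩ := hd x ⟨⟨hx0.le, hx1.le⟩, by simpa using hxF⟩
        refine ⟨d - lam, ?_, by linarith⟩
        have h_id : HasDerivAt (fun y : ℝ => lam * y) lam x := by
          simpa using (hasDerivAt_id x).const_mul lam
        exact (h_d.hasDerivAt (Icc_mem_nhds hx0 hx1)).sub h_id)
    linarith
  have hl : ∀ p q, 0 ≤ p → p ≤ q → q < c → lam * (q - p) ≤ f q - f p := fun p q hp hpq hq =>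
    key p q hp hpq (hq.trans hc1).le
      (hf.cont_left.mono fun x hx => ⟨hp.trans hx.1, hx.2.trans_lt hq⟩)
  have hr : ∀ p q, c < p → p ≤ q → q ≤ 1 → lam * (q - p) ≤ f q - f p := fun p q hp hpq hq =>
    key p q (hc0.trans hp).le hpq hq
      (hf.cont_right.mono fun x hx => ⟨hp.trans_le hx.1, hx.2.trans hq⟩)
  refine ⟨lam, hlam, hl, hr, ?_, ?_⟩
  · intro p hp hpc
    have h₁ : Tendsto (fun q : ℝ => lam * (q - p)) (𝓝[<] c) (𝓝 (lam * (c - p))) :=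
      ((by fun_prop : Continuous fun q : ℝ => lam * (q - p)).tendsto c).mono_left
        nhdsWithin_le_nhds
    have h₂ : Tendsto (fun q : ℝ => f q - f p) (𝓝[<] c) (𝓝 (1 - f p)) :=
      hf.lim_left.sub_const (f p)
    refine le_of_tendsto_of_tendsto h₁ h₂ ?_
    filter_upwards [Ioo_mem_nhdsLT hpc] with q hq
    exact hl p q hp hq.1.le hq.2
  · intro q hcq hq
    have h₁ : Tendsto (fun p : ℝ => lam * (q - p)) (𝓝[>] c) (𝓝 (lam * (q - c))) :=
      ((by fun_prop : Continuous fun p : ℝ => lam * (q - p)).tendsto c).mono_left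
        nhdsWithin_le_nhds
    have h₂ : Tendsto (fun p : ℝ => f q - f p) (𝓝[>] c) (𝓝 (f q - 0)) :=
      hf.lim_right.const_sub (f q)
    rw [← sub_zero (f q)]
    refine le_of_tendsto_of_tendsto h₁ h₂ ?_
    filter_upwards [Ioo_mem_nhdsGT hcq] with p hp
    exact hr p q hp.1 hp.2.le hq

theorem sub_le_of_stretch {lam p q d : ℝ} (hlam : 1 < lam) (hpq : p ≤ q)
    (h : lam * (q - p) ≤ d) : q - p ≤ d :=
  (le_mul_of_one_le_left (sub_nonneg.2 hpq) hlam.le).trans h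

theorem Nat.add_mod_pos_of_ne_sub {n k i : ℕ} (hk : k < n) (hi : 0 < i) (hin : i < n)
    (hne : i ≠ n - k) : 0 < (i + k) % n ∧ (i - 1 + k) % n = (i + k) % n - 1 := by
  rcases lt_or_ge (i + k) n with h | h
  · rw [Nat.mod_eq_of_lt h, Nat.mod_eq_of_lt (by omega : i - 1 + k < n)]
    omega
  · rw [Nat.mod_eq_sub_mod h, Nat.mod_eq_sub_mod (by omega : n ≤ i - 1 + k),
      Nat.mod_eq_of_lt (by omega : i + k - n < n), Nat.mod_eq_of_lt (by omega : i - 1 + k - n < n)]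
    omega

theorem Nat.Coprime.exists_add_mul_mod_eq {n k : ℕ} (h : Nat.Coprime n k) (i : ℕ) {r : ℕ}
    (hr : r < n) : ∃ t : ℕ, (i + t * k) % n = r := by
  have : NeZero n := ⟨by omega⟩
  refine ⟨(((r : ZMod n) - i) * (k : ZMod n)⁻¹).val, ?_⟩
  rw [← Nat.mod_eq_of_lt hr]
  refine (ZMod.natCast_eq_natCast_iff' _ _ _).1 ?_
  have hu : (k : ZMod n) * (k : ZMod n)⁻¹ = 1 := ZMod.coe_mul_inv_eq_one k h.symm
  rw [Nat.cast_add, Nat.cast_mul, ZMod.natCast_zmod_val, mul_assoc, mul_comm (k : ZMod n)⁻¹, hu]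
  simp

namespace IsPrimaryCycle

variable {f : ℝ → ℝ} {c : ℝ} {n k : ℕ} {z : ℕ → ℝ}

theorem monotone (hz : IsPrimaryCycle f c n k z) {i j : ℕ} (hij : i ≤ j) (hj : j < n) :
    z i ≤ z j := by
  rcases hij.eq_or_lt with rfl | h
  · exact le_rfl
  · exact (hz.mono i j h hj).le

theorem iterate_eq (hz : IsPrimaryCycle f c n k z) {m : ℕ} (hm : m < n) (j : ℕ) :
    f^[j] (z m) = z ((m + j * k) % n) := by
  induction j with
  | zero => simp [Nat.mod_eq_of_lt hm]
  | succ j ih =>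
    rw [iterate_succ_apply', ih, hz.step _ (Nat.mod_lt _ (by omega)), Nat.mod_add_mod]
    congr 2
    ring

theorem cell_step (hz : IsPrimaryCycle f c n k z) {lam : ℝ}
    (hl : ∀ p q, 0 ≤ p → p ≤ q → q < c → lam * (q - p) ≤ f q - f p)
    (hr : ∀ p q, c < p → p ≤ q → q ≤ 1 → lam * (q - p) ≤ f q - f p)
    {i : ℕ} (hi : 0 < i) (hin : i < n) (hne : i ≠ n - k) {p q : ℝ}
    (hp : z (i - 1) ≤ p) (hpq : p ≤ q) (hq : q ≤ z i) : lam * (q - p) ≤ f q - f p := by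
  rcases lt_or_ge i (n - k) with h | h
  · exact hl p q ((hz.mem (i - 1) (by omega)).1.trans hp) hpq (hq.trans_lt (hz.left_of_c i h))
  · exact hr p q ((hz.right_of_c (i - 1) (by omega) (by omega)).trans_le hp) hpq
      (hq.trans (hz.mem i hin).2)

theorem step_pred (hz : IsPrimaryCycle f c n k z) {i : ℕ} (hi : 0 < i) (hin : i < n)
    (hne : i ≠ n - k) : f (z (i - 1)) = z ((i + k) % n - 1) := by
  rw [hz.step (i - 1) (by omega), (Nat.add_mod_pos_of_ne_sub hz.k_lt_n hi hin hne).2]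

theorem mul_mod_pos (hz : IsPrimaryCycle f c n k z) {j : ℕ} (hj : 0 < j) (hjn : j < n) :
    0 < (j * k) % n := by
  rw [Nat.pos_iff_ne_zero]
  intro h
  have := Nat.le_of_dvd hj (hz.coprime.dvd_of_dvd_mul_right (Nat.dvd_of_mod_eq_zero h))
  omega

theorem mul_mod_ne (hz : IsPrimaryCycle f c n k z) {j : ℕ} (hjn : j + 1 < n) :
    (j * k) % n ≠ n - k := by
  intro h
  have h₁ := hz.mul_mod_pos (Nat.succ_pos j) hjn
  have := hz.k_lt_n
  rw [Nat.succ_mul, ← Nat.mod_add_mod, h, Nat.sub_add_cancel this.le, Nat.mod_self] at h₁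
  exact absurd h₁ (lt_irrefl 0)

theorem iterate_cell (hz : IsPrimaryCycle f c n k z) {lam : ℝ} (hlam : 1 < lam)
    (hl : ∀ p q, 0 ≤ p → p ≤ q → q < c → lam * (q - p) ≤ f q - f p)
    (hr : ∀ p q, c < p → p ≤ q → q ≤ 1 → lam * (q - p) ≤ f q - f p)
    {p q : ℝ} (hp : z (k - 1) ≤ p) (hpq : p ≤ q) (hq : q ≤ z k) (j : ℕ) (hj : j + 1 < n) :
    z (((j + 1) * k) % n - 1) ≤ f^[j] p ∧ f^[j] q ≤ z (((j + 1) * k) % n) ∧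
      q - p ≤ f^[j] q - f^[j] p := by
  induction j with
  | zero =>
    rw [Nat.zero_add, Nat.one_mul, Nat.mod_eq_of_lt hz.k_lt_n]
    exact ⟨hp, hq, le_rfl⟩
  | succ j ih =>
    obtain ⟨h₁, h₂, h₃⟩ := ih (by omega)
    have hi := hz.mul_mod_pos (Nat.succ_pos j) (by omega)
    have hin : ((j + 1) * k) % n < n := Nat.mod_lt _ (by omega)
    have hne := hz.mul_mod_ne hj
    have hle : f^[j] p ≤ f^[j] q := by linarith
    have e : ((j + 1 + 1) * k) % n = (((j + 1) * k) % n + k) % n := by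
      rw [Nat.mod_add_mod, ← Nat.succ_mul]
    have s₁ := hz.cell_step hl hr hi hin hne le_rfl h₁ (hle.trans h₂)
    have s₂ := hz.cell_step hl hr hi hin hne h₁ hle h₂
    have s₃ := hz.cell_step hl hr hi hin hne (h₁.trans hle) h₂ le_rfl
    rw [hz.step_pred hi hin hne] at s₁
    rw [hz.step _ hin] at s₃
    simp only [iterate_succ_apply', e]
    have w₁ := sub_le_of_stretch hlam h₁ s₁
    have w₂ := sub_le_of_stretch hlam hle s₂
    have w₃ := sub_le_of_stretch hlam h₂ s₃
    refine ⟨?_, ?_, ?_⟩ <;> linarith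

theorem exists_iterate_mem_critical_cell (hz : IsPrimaryCycle f c n k z) {lam : ℝ}
    (hlam : 1 < lam)
    (hl : ∀ p q, 0 ≤ p → p ≤ q → q < c → lam * (q - p) ≤ f q - f p)
    (hr : ∀ p q, c < p → p ≤ q → q ≤ 1 → lam * (q - p) ≤ f q - f p) (t : ℕ) :
    ∀ (i : ℕ) (y : ℝ), 0 < i → i < n → z (i - 1) < y → y < z i → (i + t * k) % n = n - k →
      ∃ m : ℕ, f^[m] y ∈ Ioo (z (n - k - 1)) (z (n - k)) := by
  induction t with
  | zero =>
    intro i y _ hin h₁ h₂ ht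
    rw [Nat.zero_mul, Nat.add_zero, Nat.mod_eq_of_lt hin] at ht
    subst ht
    exact ⟨0, h₁, h₂⟩
  | succ t ih =>
    intro i y hi hin h₁ h₂ ht
    by_cases hne : i = n - k
    · subst hne
      exact ⟨0, h₁, h₂⟩
    have s₁ := hz.cell_step hl hr hi hin hne le_rfl h₁.le h₂.le
    have s₂ := hz.cell_step hl hr hi hin hne h₁.le h₂.le le_rfl
    rw [hz.step_pred hi hin hne] at s₁
    rw [hz.step _ hin] at s₂
    have w₁ := sub_le_of_stretch hlam h₁.le s₁
    have w₂ := sub_le_of_stretch hlam h₂.le s₂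
    obtain ⟨m, hm⟩ := ih ((i + k) % n) (f y) (Nat.add_mod_pos_of_ne_sub hz.k_lt_n hi hin hne).1
      (Nat.mod_lt _ (by omega)) (by linarith) (by linarith)
      (by rw [Nat.mod_add_mod, ← ht]; congr 1; ring)
    exact ⟨m + 1, hm⟩

theorem exists_cell (hz : IsPrimaryCycle f c n k z) {x : ℝ} (hx₀ : z 0 < x) (hx₁ : x < z (n - 1))
    (hx : ∀ m < n, z m ≠ x) : ∃ i, 0 < i ∧ i < n ∧ z (i - 1) < x ∧ x < z i := by
  classical
  have h : ∃ i, x < z i := ⟨_, hx₁⟩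
  have hk := hz.k_lt_n
  have hle : Nat.find h ≤ n - 1 := Nat.find_min' h hx₁
  have hpos : 0 < Nat.find h := by
    rw [Nat.pos_iff_ne_zero]
    intro h₀
    have := Nat.find_spec h
    rw [h₀] at this
    exact lt_asymm hx₀ this
  refine ⟨Nat.find h, hpos, by omega, ?_, Nat.find_spec h⟩
  exact lt_of_le_of_ne (not_lt.1 (Nat.find_min h (by omega))) (hx _ (by omega))

end IsPrimaryCycle

theorem exists_iterate_mem_Ioo_of_stretch_left {g : ℝ → ℝ} {a c u v lam : ℝ} (hlam : 1 < lam)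
    (huc : u < c) (hg : ∀ w, a < w → w < c → g w < v ∧ lam * (w - a) ≤ g w - a)
    {y : ℝ} (hay : a < y) (hyc : y < c) : ∃ j : ℕ, g^[j] y ∈ Ioo u v := by
  by_contra! hav
  have main : ∀ j, g^[j] y < c ∧ lam ^ j * (y - a) ≤ g^[j] y - a := by
    intro j
    induction j with
    | zero => simpa using hyc
    | succ j ih =>
      have hav' := hav (j + 1)
      rw [iterate_succ_apply'] at hav' ⊢
      obtain ⟨ih₁, ih₂⟩ := ih
      have hpos : 0 < lam ^ j * (y - a) := mul_pos (by positivity) (sub_pos.2 hay)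
      obtain ⟨h₁, h₂⟩ := hg (g^[j] y) (by linarith) ih₁
      refine ⟨lt_of_not_ge fun hge => hav' ⟨huc.trans_le hge, h₁⟩, ?_⟩
      calc lam ^ (j + 1) * (y - a) = lam * (lam ^ j * (y - a)) := by ring
        _ ≤ lam * (g^[j] y - a) := by gcongr
        _ ≤ g (g^[j] y) - a := h₂
  obtain ⟨j, hj⟩ := pow_unbounded_of_one_lt ((c - a) / (y - a)) hlam
  rw [div_lt_iff₀ (sub_pos.2 hay)] at hj
  linarith [main j]

theorem exists_iterate_mem_Ioo_of_stretch_right {g : ℝ → ℝ} {b c u v lam : ℝ} (hlam : 1 < lam)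
    (hcv : c < v) (hg : ∀ w, c < w → w < b → u < g w ∧ lam * (b - w) ≤ b - g w)
    {y : ℝ} (hcy : c < y) (hyb : y < b) : ∃ j : ℕ, g^[j] y ∈ Ioo u v := by
  by_contra! hav
  have main : ∀ j, c < g^[j] y ∧ lam ^ j * (b - y) ≤ b - g^[j] y := by
    intro j
    induction j with
    | zero => simpa using hcy
    | succ j ih =>
      have hav' := hav (j + 1)
      rw [iterate_succ_apply'] at hav' ⊢
      obtain ⟨ih₁, ih₂⟩ := ih
      have hpos : 0 < lam ^ j * (b - y) := mul_pos (by positivity) (sub_pos.2 hyb)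
      obtain ⟨h₁, h₂⟩ := hg (g^[j] y) ih₁ (by linarith)
      refine ⟨lt_of_not_ge fun hge => hav' ⟨h₁, hge.trans_lt hcv⟩, ?_⟩
      calc lam ^ (j + 1) * (b - y) = lam * (lam ^ j * (b - y)) := by ring
        _ ≤ lam * (b - g^[j] y) := by gcongr
        _ ≤ b - g (g^[j] y) := h₂
  obtain ⟨j, hj⟩ := pow_unbounded_of_one_lt ((b - c) / (b - y)) hlam
  rw [div_lt_iff₀ (sub_pos.2 hyb)] at hj
  linarith [main j]

/-- for a primary `n(k)`-cycle with `z (k-1) ≠ f 0` and `z k ≠ f 1`,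
the set of points whose forward orbit never enters `(u,v)` is exactly the cycle. -/
theorem avoiding_set_eq_cycle
    (f : ℝ → ℝ) (c : ℝ) (n k : ℕ) (z : ℕ → ℝ)
    (hf : IsExpandingLorenz f c) (hz : IsPrimaryCycle f c n k z)
    (h0 : z (k - 1) ≠ f 0) (h1 : z k ≠ f 1) :
    {x ∈ Set.Icc (0:ℝ) 1 | ∀ m : ℕ, (∀ i < m, f^[i] x ≠ c) →
        f^[m] x ∉ Set.Ioo (f^[n-1] (0:ℝ)) (f^[n-1] (1:ℝ))}
      = {y : ℝ | ∃ m < n, z m = y} := by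
  obtain ⟨lam, hlam, hl, hr, hlc, hrc⟩ := hf.exists_stretch
  have hk := hz.k_pos
  have hkn := hz.k_lt_n
  have hzl : z (n - k - 1) < c := hz.left_of_c _ (by omega)
  have hzr : c < z (n - k) := hz.right_of_c _ le_rfl (by omega)
  have hzl0 := (hz.mem (n - k - 1) (by omega)).1
  have hzr1 := (hz.mem (n - k) (by omega)).2
  have hz0 := (hz.mem 0 (by omega)).1
  have hz1 := (hz.mem (n - 1) (by omega)).2
  have hz0c : z 0 < c := hz.left_of_c _ (by omega)
  have hz1c : c < z (n - 1) := hz.right_of_c _ (by omega) (by omega)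
  have e0 : f (z 0) = z k := by rw [hz.step 0 (by omega), Nat.zero_add, Nat.mod_eq_of_lt hkn]
  have e1 : f (z (n - 1)) = z (k - 1) := by
    rw [hz.step _ (by omega), show n - 1 + k = k - 1 + n by omega, Nat.add_mod_right,
      Nat.mod_eq_of_lt (by omega)]
  have el : f (z (n - k - 1)) = z (n - 1) := by
    rw [hz.step _ (by omega), show n - k - 1 + k = n - 1 by omega, Nat.mod_eq_of_lt (by omega)]
  have er : f (z (n - k)) = z 0 := by
    rw [hz.step _ (by omega), Nat.sub_add_cancel hkn.le, Nat.mod_self]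
  have hmod : ((n - 2 + 1) * k) % n = n - k := by
    have : (n - 2 + 1) * k = n - k + n * (k - 1) := by
      obtain ⟨a, rfl⟩ : ∃ a, n = k + a := ⟨n - k, by omega⟩
      obtain ⟨b, rfl⟩ : ∃ b, k = b + 1 := ⟨k - 1, by omega⟩
      rw [show b + 1 + a - 2 + 1 = b + a by omega, Nat.add_sub_cancel_left, Nat.add_sub_cancel]
      ring
    rw [this, Nat.add_mul_mod_self_left, Nat.mod_eq_of_lt (by omega)]
  have cell := fun {p q : ℝ} (hp : z (k - 1) ≤ p) (hpq : p ≤ q) (hq : q ≤ z k) =>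
    hz.iterate_cell hlam hl hr hp hpq hq (n - 2) (by omega)
  rw [hmod] at cell
  have E0 : f^[n - 2] (z (k - 1)) = z (n - k - 1) := by
    rw [← e1, ← el, ← iterate_succ_apply, ← iterate_succ_apply, hz.iterate_eq (by omega),
      show (n - 2).succ.succ = n by omega, Nat.add_mul_mod_self_left, Nat.mod_eq_of_lt (by omega)]
  have E1 : f^[n - 2] (z k) = z (n - k) := by
    rw [← e0, ← er, ← iterate_succ_apply, ← iterate_succ_apply, hz.iterate_eq (by omega),
      show (n - 2).succ.succ = n by omega, Nat.add_mul_mod_self_left, Nat.mod_eq_of_lt (by omega)]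
  have iter1 : ∀ y, f^[n - 1] y = f^[n - 2] (f y) := fun y => by
    rw [← iterate_succ_apply, show (n - 2).succ = n - 1 by omega]
  have iter2 : ∀ y, f^[n] y = f^[n - 2] (f (f y)) := fun y => by
    rw [← iterate_succ_apply, ← iterate_succ_apply, show (n - 2).succ.succ = n by omega]
  have hll := fun {p q : ℝ} (hp : 0 ≤ p) (hpq : p ≤ q) (hq : q < c) =>
    sub_le_of_stretch hlam hpq (hl p q hp hpq hq)
  have hlr := fun {p q : ℝ} (hp : c < p) (hpq : p ≤ q) (hq : q ≤ 1) =>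
    sub_le_of_stretch hlam hpq (hr p q hp hpq hq)
  have d0 := hll le_rfl hz0 hz0c
  have d1 := hlr hz1c hz1 le_rfl
  rw [e0] at d0
  rw [e1] at d1
  have hf0 : f 0 ≤ z k := by linarith
  have hf1 : z (k - 1) ≤ f 1 := by linarith
  have hf0' : z (k - 1) < f 0 := lt_of_le_of_ne hz.le_f0 h0
  have hf1' : f 1 < z k := lt_of_le_of_ne hz.f1_le h1.symm
  rw [iter1 0, iter1 1]
  set u := f^[n - 2] (f 0)
  set v := f^[n - 2] (f 1)
  have hul : z (n - k - 1) ≤ u := (cell hf0'.le le_rfl hf0).1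
  have hvr : v ≤ z (n - k) := (cell hf1 le_rfl hf1'.le).2.1
  have huc : u < c := by
    have := (cell hf0'.le hf0 le_rfl).2.2
    rw [E1] at this
    have a := (lt_mul_of_one_lt_left (sub_pos.2 hzr) hlam).trans_le (hrc _ hzr hzr1)
    rw [er] at a
    linarith
  have hcv : c < v := by
    have := (cell le_rfl hf1 hf1'.le).2.2
    rw [E0] at this
    have a := (lt_mul_of_one_lt_left (sub_pos.2 hzl) hlam).trans_le (hlc _ hzl0 hzl)
    rw [el] at a
    linarith
  have stepl : ∀ w, z (n - k - 1) < w → w < c →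
      f^[n] w < v ∧ lam * (w - z (n - k - 1)) ≤ f^[n] w - z (n - k - 1) := by
    intro w hw hwc
    have a₁ := hl _ _ hzl0 hw.le hwc
    have a₁' := sub_le_of_stretch hlam hw.le a₁
    have a₂ := sub_le_of_stretch hlam hwc.le (hlc w (hzl0.trans hw.le) hwc)
    rw [el] at a₁ a₁'
    have hw1 : f w < 1 := by linarith
    have hw2 : z (n - 1) < f w := by linarith
    have b₁ := hlr hz1c hw2.le hw1.le
    have b₂ := hlr (hz1c.trans hw2) hw1.le le_rfl
    rw [e1] at b₁
    have hw3 : z (k - 1) ≤ f (f w) := by linarith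
    have hw4 : f (f w) < f 1 := by linarith
    have c₁ := (cell le_rfl hw3 (hw4.trans hf1').le).2.2
    have c₂ := (cell hw3 hw4.le hf1'.le).2.2
    rw [E0] at c₁
    rw [iter2]
    exact ⟨by linarith, by linarith⟩
  have stepr : ∀ w, c < w → w < z (n - k) →
      u < f^[n] w ∧ lam * (z (n - k) - w) ≤ z (n - k) - f^[n] w := by
    intro w hcw hw
    have a₁ := hr _ _ hcw hw.le hzr1
    have a₁' := sub_le_of_stretch hlam hw.le a₁
    have a₂ := sub_le_of_stretch hlam hcw.le (hrc w hcw (hw.le.trans hzr1))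
    rw [er] at a₁ a₁'
    have hw1 : 0 < f w := by linarith
    have hw2 : f w < z 0 := by linarith
    have b₁ := hll hw1.le hw2.le hz0c
    have b₂ := hll le_rfl hw1.le (hw2.trans hz0c)
    rw [e0] at b₁
    have hw3 : f (f w) ≤ z k := by linarith
    have hw4 : f 0 < f (f w) := by linarith
    have c₁ := (cell (hf0'.trans hw4).le hw3 le_rfl).2.2
    have c₂ := (cell hf0'.le hw4.le hw3).2.2
    rw [E1] at c₁
    rw [iter2]
    exact ⟨by linarith, by linarith⟩
  ext x
  constructor
  · rintro ⟨hx, hxav⟩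
    have hav : ∀ m, f^[m] x ∉ Ioo u v := by
      intro m
      induction m using Nat.strong_induction_on with
      | _ m ih => exact hxav m fun i hi h => ih i hi (h ▸ ⟨huc, hcv⟩)
    by_contra hxz
    have hxz' : ∀ m < n, z m ≠ x := fun m hm h => hxz ⟨m, hm, h⟩
    have inner : ∀ (i m : ℕ), 0 < i → i < n → z (i - 1) < f^[m] x → f^[m] x < z i →
        ∃ m, f^[m] x ∈ Ioo (z (n - k - 1)) (z (n - k)) := by
      intro i m hi hin h₁ h₂
      obtain ⟨t, ht⟩ := hz.coprime.exists_add_mul_mod_eq i (by omega : n - k < n)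
      obtain ⟨j, hj⟩ := hz.exists_iterate_mem_critical_cell hlam hl hr t i _ hi hin h₁ h₂ ht
      exact ⟨j + m, by rwa [iterate_add_apply]⟩
    have reach : ∃ m, f^[m] x ∈ Ioo (z (n - k - 1)) (z (n - k)) := by
      rcases lt_or_gt_of_ne (hxz' 0 (by omega)) with hx0 | hx0
      · rcases lt_or_gt_of_ne (hxz' (n - 1) (by omega)) with hx1 | hx1
        · have a₁ := hlr hz1c hx1.le hx.2
          have a₂ := hlr (hz1c.trans hx1) hx.2 le_rfl
          refine inner k 1 hk hkn ?_ ?_ <;> rw [iterate_one] <;> linarith [hx.2]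
        · obtain ⟨i, hi, hin, h₁, h₂⟩ := hz.exists_cell hx0 hx1 hxz'
          exact inner i 0 hi hin h₁ h₂
      · have a₁ := hll hx.1 hx0.le hz0c
        have a₂ := hll le_rfl hx.1 (hx0.trans hz0c)
        refine inner k 1 hk hkn ?_ ?_ <;> rw [iterate_one] <;> linarith [hx.1]
    obtain ⟨m, hm⟩ := reach
    have hyav : ∀ j, f^[j] (f^[m] x) ∉ Ioo u v := fun j => by
      rw [← iterate_add_apply]; exact hav _
    generalize f^[m] x = y at hm hyav
    have hyc : y ≠ c := fun h => hyav 0 (h ▸ ⟨huc, hcv⟩)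
    rcases lt_or_gt_of_ne hyc with hyc | hyc
    · obtain ⟨j, hj⟩ := exists_iterate_mem_Ioo_of_stretch_left hlam huc stepl hm.1 hyc
      exact hyav (n * j) (by rwa [iterate_mul])
    · obtain ⟨j, hj⟩ := exists_iterate_mem_Ioo_of_stretch_right hlam hcv stepr hyc hm.2
      exact hyav (n * j) (by rwa [iterate_mul])
  · rintro ⟨m, hm, rfl⟩
    refine ⟨hz.mem m hm, fun j _ => ?_⟩
    rw [hz.iterate_eq hm]
    have hi : (m + j * k) % n < n := Nat.mod_lt _ (by omega)
    generalize (m + j * k) % n = i at hi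
    rintro ⟨h₁, h₂⟩
    rcases lt_or_ge i (n - k) with h | h
    · linarith [hz.monotone (by omega : i ≤ n - k - 1) (by omega)]
    · linarith [hz.monotone h hi]
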